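/- arXiv:2506.12663 — 3 statements merged into one kernel-verified Lean document; each statement's English description precedes it below -/
import Mathlib

section
/- Two distinct signed partial involutions in SPI⁺_m (symmetric matrices with entries in {-1,0,1}, at most one nonzero entry in each row and column, nonnegative off-diagonal entries) lie in distinct orbits under the action b·z = b z b* of the upper triangular group B_m(ℂ) on Hermitian matrices. -/
open Matrix

/-- A signed partial involution with nonnegative off-diagonal entries. -/
def IsSPIplus {m : ℕ} (τ : Matrix (Fin m) (Fin m) ℤ) : Prop :=
  τ.IsSymm ∧
  (∀ i j, τ i j = -1 ∨ τ i j = 0 ∨ τ i j = 1) ∧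
  (∀ i j k, τ i j ≠ 0 → τ i k ≠ 0 → j = k) ∧
  (∀ i j k, τ i k ≠ 0 → τ j k ≠ 0 → i = j) ∧
  (∀ i j, i ≠ j → 0 ≤ τ i j)

lemma upper_mul_diag {m : ℕ} {a b : Matrix (Fin m) (Fin m) ℂ} (ha : a.BlockTriangular id)
    (hb : b.BlockTriangular id) (k : Fin m) : (a * b) k k = a k k * b k k := by
  rw [Matrix.mul_apply, Finset.sum_eq_single k]
  · intro l _ hl
    rcases lt_or_gt_of_ne hl with h | h
    · rw [ha (show id l < id k from h), zero_mul]
    · rw [hb (show id k < id l from h), mul_zero]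
  · simp

/-- The `(k, j)` entry of `b τ = τ' c`, for `τ k j ≠ 0`. -/
lemma entry_left {m : ℕ} {τ : Matrix (Fin m) (Fin m) ℤ} (h : IsSPIplus τ)
    (b : Matrix (Fin m) (Fin m) ℂ) {k j : Fin m} (hk : τ k j ≠ 0) :
    (b * τ.map (fun x : ℤ => (x : ℂ))) k j = b k k * (τ k j : ℂ) := by
  rw [Matrix.mul_apply, Finset.sum_eq_single k]
  · simp
  · intro l _ hl
    have : τ l j = 0 := by
      by_contra h0
      exact hl (h.2.2.2.1 l k j h0 hk)
    simp [this]
  · simp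

lemma entry_right {m : ℕ} {τ : Matrix (Fin m) (Fin m) ℤ} (h : IsSPIplus τ)
    (c : Matrix (Fin m) (Fin m) ℂ) {k l : Fin m} (hk : τ k l ≠ 0) (j : Fin m) :
    (τ.map (fun x : ℤ => (x : ℂ)) * c) k j = (τ k l : ℂ) * c l j := by
  rw [Matrix.mul_apply, Finset.sum_eq_single l]
  · simp
  · intro i _ hl
    have : τ k i = 0 := by
      by_contra h0
      exact hl (h.2.2.1 k i l h0 hk)
    simp [this]
  · simp

lemma exists_ge {m : ℕ} {τ τ' : Matrix (Fin m) (Fin m) ℤ} (h : IsSPIplus τ)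
    {b a : Matrix (Fin m) (Fin m) ℂ} (hb : ∀ k, b k k ≠ 0)
    (ha : a.BlockTriangular id)
    (e : b * τ.map (fun x : ℤ => (x : ℂ)) = τ'.map (fun x : ℤ => (x : ℂ)) * aᴴ)
    {k j : Fin m} (hk : τ k j ≠ 0) : ∃ l, j ≤ l ∧ τ' k l ≠ 0 := by
  by_contra! hc
  have h1 := entry_left h b hk
  rw [e, Matrix.mul_apply, Finset.sum_eq_zero] at h1
  · exact mul_ne_zero (hb k) (by exact_mod_cast hk) h1.symm
  · intro l _
    rcases le_or_gt j l with hl | hl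
    · simp [hc l hl]
    · simp [Matrix.conjTranspose_apply, ha (show id l < id j from hl)]

/-- Two distinct elements of `SPI⁺_m` lie in distinct orbits of the upper triangular
group `B_m(ℂ)` acting on Hermitian matrices by `b · z = b z b*`. -/
theorem stmt1 {m : ℕ} (τ τ' : Matrix (Fin m) (Fin m) ℤ)
    (h : IsSPIplus τ) (h' : IsSPIplus τ') (hne : τ ≠ τ') :
    ¬ ∃ b : Matrix (Fin m) (Fin m) ℂ, IsUnit b ∧ b.BlockTriangular id ∧
        b * τ.map (fun x : ℤ => (x : ℂ)) * bᴴ = τ'.map (fun x : ℤ => (x : ℂ)) := by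
  rintro ⟨b, hu, hb, e⟩
  apply hne
  have hdet : IsUnit b.det := (Matrix.isUnit_iff_isUnit_det b).1 hu
  have hi1 : b⁻¹ * b = 1 := Matrix.nonsing_inv_mul b hdet
  have hi2 : b * b⁻¹ = 1 := Matrix.mul_nonsing_inv b hdet
  haveI : Invertible b := hu.invertible
  have hbi : (b⁻¹).BlockTriangular id := Matrix.blockTriangular_inv_of_blockTriangular hb
  have hd : ∀ k, b⁻¹ k k * b k k = 1 := fun k => by
    rw [← upper_mul_diag hbi hb, hi1, Matrix.one_apply_eq]
  have hb0 : ∀ k, b k k ≠ 0 := fun k h0 => by simpa [h0] using hd k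
  have hbi0 : ∀ k, b⁻¹ k k ≠ 0 := fun k h0 => by simpa [h0] using hd k
  have hc : bᴴ * (b⁻¹)ᴴ = 1 := by
    rw [← Matrix.conjTranspose_mul, hi1, Matrix.conjTranspose_one]
  have e1 : b * τ.map (fun x : ℤ => (x : ℂ)) = τ'.map (fun x : ℤ => (x : ℂ)) * (b⁻¹)ᴴ := by
    rw [← e, Matrix.mul_assoc, hc, Matrix.mul_one]
  have e2 : b⁻¹ * τ'.map (fun x : ℤ => (x : ℂ)) = τ.map (fun x : ℤ => (x : ℂ)) * bᴴ := by
    rw [← e, Matrix.mul_assoc, ← Matrix.mul_assoc, hi1, Matrix.one_mul]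
  have s1 : ∀ k j, τ k j ≠ 0 → τ' k j ≠ 0 := fun k j hk => by
    obtain ⟨l, hl, hl'⟩ := exists_ge h hb0 hbi e1 hk
    obtain ⟨i, hi, hi'⟩ := exists_ge h' hbi0 hb e2 hl'
    obtain rfl := h.2.2.1 k i j hi' hk
    rwa [le_antisymm hl hi]
  have s2 : ∀ k j, τ' k j ≠ 0 → τ k j ≠ 0 := fun k j hk => by
    obtain ⟨l, hl, hl'⟩ := exists_ge h' hbi0 hb e2 hk
    obtain ⟨i, hi, hi'⟩ := exists_ge h hb0 hbi e1 hl'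
    obtain rfl := h'.2.2.1 k i j hi' hk
    rwa [le_antisymm hl hi]
  ext k j
  by_cases hz : τ k j = 0
  · rw [hz]
    by_contra h0
    exact s2 k j (Ne.symm h0) hz
  have hz' := s1 k j hz
  have t1 := h.2.1 k j
  have t2 := h'.2.1 k j
  by_cases hkj : k = j
  · subst hkj
    have h1 := entry_left h b hz
    rw [e1, entry_right h' _ hz', Matrix.conjTranspose_apply] at h1
    have h2 : star (b⁻¹ k k) * star (b k k) = 1 := by
      rw [← star_mul', hd k, star_one]
    have h3 : ((τ' k k : ℤ) : ℂ) = ((Complex.normSq (b k k) * (τ k k : ℝ) : ℝ) : ℂ) := by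
      push_cast
      rw [← Complex.mul_conj]
      have h4 : (starRingEnd ℂ) (b k k) = star (b k k) := rfl
      rw [h4]
      linear_combination star (b k k) * h1 - (τ' k k : ℂ) * h2
    have h5 : (τ' k k : ℝ) = Complex.normSq (b k k) * (τ k k : ℝ) := by exact_mod_cast h3
    have h6 := Complex.normSq_nonneg (b k k)
    rcases t1 with t1 | t1 | t1 <;> rcases t2 with t2 | t2 | t2 <;>
      first
      | exact absurd t1 hz
      | exact absurd t2 hz'
      | (rw [t1, t2]; done)
      | (exfalso; rw [t1, t2] at h5; push_cast at h5; linarith)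
  · have u1 := h.2.2.2.2 k j hkj
    have u2 := h'.2.2.2.2 k j hkj
    omega
end

section
/- The map sending τ ∈ SPI⁺_m to its B_m(ℂ)-orbit is a bijection between SPI⁺_m and the set of orbits of B_m(ℂ) acting on Her_m(ℂ) by b·z = b z b*. -/
open Matrix

theorem spiMap_isHermitian {m : ℕ} {τ : Matrix (Fin m) (Fin m) ℤ} (h : τ.IsSymm) :
    (τ.map (fun x : ℤ => (x : ℂ))).IsHermitian := by
  show _ᴴ = _
  ext i j
  simp [Matrix.conjTranspose_apply, Matrix.map_apply, h.apply i j]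

/-- The orbit relation of `B_m(ℂ)` acting by `b · z = b z b*` on Hermitian matrices. -/
def BOrbitRel (m : ℕ) (z z' : {z : Matrix (Fin m) (Fin m) ℂ // z.IsHermitian}) : Prop :=
  ∃ b : Matrix (Fin m) (Fin m) ℂ, IsUnit b ∧ b.BlockTriangular id ∧
    b * (z : Matrix (Fin m) (Fin m) ℂ) * bᴴ = (z' : Matrix (Fin m) (Fin m) ℂ)


theorem borbit_refl {m : ℕ} (z) : BOrbitRel m z z :=
  ⟨1, isUnit_one, Matrix.blockTriangular_one, by simp⟩

theorem borbit_trans {m : ℕ} {x y z} (h : BOrbitRel m x y) (h' : BOrbitRel m y z) :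
    BOrbitRel m x z := by
  obtain ⟨b, hb, tb, e⟩ := h
  obtain ⟨c, hc, tc, e'⟩ := h'
  refine ⟨c * b, hc.mul hb, tc.mul tb, ?_⟩
  rw [← e', ← e, Matrix.conjTranspose_mul]
  simp only [Matrix.mul_assoc]

theorem borbit_symm {m : ℕ} {x y} (h : BOrbitRel m x y) :
    BOrbitRel m y x := by
  obtain ⟨b, hb, tb, e⟩ := h
  have hd : IsUnit b.det := (Matrix.isUnit_iff_isUnit_det b).1 hb
  have hinv : Invertible b := hb.invertible
  refine ⟨b⁻¹, ?_, Matrix.blockTriangular_inv_of_blockTriangular tb, ?_⟩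
  · exact (Matrix.isUnit_nonsing_inv_iff).2 hb
  · rw [← e]
    have h1 : bᴴ * (b⁻¹)ᴴ = 1 := by
      rw [← Matrix.conjTranspose_mul, Matrix.nonsing_inv_mul _ hd, Matrix.conjTranspose_one]
    calc b⁻¹ * (b * x.1 * bᴴ) * (b⁻¹)ᴴ = (b⁻¹ * b) * x.1 * (bᴴ * (b⁻¹)ᴴ) := by
          simp only [Matrix.mul_assoc]
      _ = x.1 := by rw [h1, Matrix.nonsing_inv_mul _ hd]; simp

theorem borbit_exact {m : ℕ} {x y}
    (h : Quot.mk (BOrbitRel m) x = Quot.mk (BOrbitRel m) y) : BOrbitRel m x y := by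
  have := Quot.eqvGen_exact h
  clear h
  induction this with
  | rel _ _ h => exact h
  | refl x => exact borbit_refl x
  | symm _ _ h ih => exact borbit_symm ih
  | trans _ _ _ h h' ih ih' =>
    exact borbit_trans ih ih'

theorem tri_diag_ne {m : ℕ} {b : Matrix (Fin m) (Fin m) ℂ} (hb : IsUnit b)
    (tb : b.BlockTriangular id) (i : Fin m) : b i i ≠ 0 := by
  have hd : IsUnit b.det := (Matrix.isUnit_iff_isUnit_det b).1 hb
  rw [Matrix.det_of_isUpperTriangular tb] at hd
  exact (Finset.prod_ne_zero_iff.1 hd.ne_zero) i (Finset.mem_univ i)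

/-- Key comparison: with `b τ = τ' c`, `c` lower triangular. -/
theorem spi_key {m : ℕ} {s t : Matrix (Fin m) (Fin m) ℤ} (hs : IsSPIplus s) (ht : IsSPIplus t)
    {b : Matrix (Fin m) (Fin m) ℂ} (hb : IsUnit b) (tb : b.BlockTriangular id)
    (e : b * s.map (fun x : ℤ => (x : ℂ)) * bᴴ = t.map (fun x : ℤ => (x : ℂ)))
    (i j : Fin m) (hij : s i j ≠ 0) :
    ∃ k, j ≤ k ∧ t i k ≠ 0 ∧
      (k = j → ((s i j : ℤ) : ℂ) * (b i i * star (b j j)) = ((t i j : ℤ) : ℂ)) := by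
  have hd : IsUnit b.det := (Matrix.isUnit_iff_isUnit_det b).1 hb
  have hinv : Invertible b := hb.invertible
  have tc : (b⁻¹).BlockTriangular id := Matrix.blockTriangular_inv_of_blockTriangular tb
  have h1 : bᴴ * (b⁻¹)ᴴ = 1 := by
    rw [← Matrix.conjTranspose_mul, Matrix.nonsing_inv_mul _ hd, Matrix.conjTranspose_one]
  have e2 : b * s.map (fun x : ℤ => (x : ℂ)) = t.map (fun x : ℤ => (x : ℂ)) * (b⁻¹)ᴴ := by
    rw [← e, Matrix.mul_assoc _ bᴴ, h1, Matrix.mul_one]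
  have e3 := congrFun (congrFun e2 i) j
  rw [Matrix.mul_apply, Matrix.mul_apply] at e3
  have hL : ∑ k, b i k * (s.map (fun x : ℤ => (x : ℂ))) k j = b i i * ((s i j : ℤ) : ℂ) := by
    rw [Finset.sum_eq_single i]
    · rfl
    · intro k _ hk
      have : s k j = 0 := by
        by_contra h
        exact hk (hs.2.2.2.1 k i j h hij)
      simp [this]
    · simp
  rw [hL] at e3
  have hne : b i i * ((s i j : ℤ) : ℂ) ≠ 0 :=
    mul_ne_zero (tri_diag_ne hb tb i) (by exact_mod_cast hij)
  rw [e3] at hne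
  obtain ⟨k, -, hk⟩ := Finset.exists_ne_zero_of_sum_ne_zero hne
  have htk : t i k ≠ 0 := by
    intro h; simp [h] at hk
  refine ⟨k, ?_, htk, ?_⟩
  · by_contra h
    push Not at h
    have : b⁻¹ j k = 0 := tc h
    simp [this] at hk
  · rintro rfl
    rw [Finset.sum_eq_single k] at e3
    · have h4 : b k k * b⁻¹ k k = 1 := by
        have := congrFun (congrFun (Matrix.mul_nonsing_inv _ hd) k) k
        rw [Matrix.mul_apply, Finset.sum_eq_single k] at this
        · simpa using this
        · intro l _ hl
          rcases lt_or_gt_of_ne hl with h | h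
          · rw [tb h, zero_mul]
          · rw [tc h, mul_zero]
        · simp
      have h5 := congrArg star h4
      simp only [star_mul', star_one] at h5
      simp only [Matrix.map_apply, Matrix.conjTranspose_apply] at e3
      calc ((s i k : ℤ) : ℂ) * (b i i * star (b k k))
          = (b i i * ((s i k : ℤ) : ℂ)) * star (b k k) := by ring
        _ = (t i k : ℂ) * (star (b k k) * star (b⁻¹ k k)) := by rw [e3]; ring
        _ = _ := by rw [h5, mul_one]
    · intro l _ hl
      have : t i l = 0 := by
        by_contra h
        exact hl (ht.2.2.1 i l k h htk)
      simp [this]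
    · simp

theorem spi_inj {m : ℕ} {s t : Matrix (Fin m) (Fin m) ℤ} (hs : IsSPIplus s) (ht : IsSPIplus t)
    (h : BOrbitRel m ⟨s.map (fun x : ℤ => (x : ℂ)), spiMap_isHermitian hs.1⟩
      ⟨t.map (fun x : ℤ => (x : ℂ)), spiMap_isHermitian ht.1⟩) : s = t := by
  have h' := borbit_symm h
  obtain ⟨b, hb, tb, e⟩ := h
  obtain ⟨c, hc, tc, e'⟩ := h'
  have K := spi_key hs ht hb tb e
  have K' := spi_key ht hs hc tc e'
  have S : ∀ i j, s i j ≠ 0 → t i j ≠ 0 := by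
    intro i j hij
    obtain ⟨k, hk, htk, -⟩ := K i j hij
    obtain ⟨l, hl, hsl, -⟩ := K' i k htk
    have : j = l := hs.2.2.1 i j l hij hsl
    have : j = k := le_antisymm hk (this ▸ hl)
    exact this ▸ htk
  have S' : ∀ i j, t i j ≠ 0 → s i j ≠ 0 := by
    intro i j hij
    obtain ⟨k, hk, htk, -⟩ := K' i j hij
    obtain ⟨l, hl, hsl, -⟩ := K i k htk
    have : j = l := ht.2.2.1 i j l hij hsl
    have : j = k := le_antisymm hk (this ▸ hl)
    exact this ▸ htk
  ext i j
  by_cases hz : s i j = 0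
  · by_contra hne
    exact S' i j (fun h => hne (by rw [hz, h])) hz
  have htz := S i j hz
  by_cases hij : i = j
  · subst hij
    obtain ⟨k, hk, htk, hh⟩ := K i i hz
    have h6 := hh (ht.2.2.1 i k i htk htz)
    have h7 : ((s i i : ℤ) : ℝ) * Complex.normSq (b i i) = ((t i i : ℤ) : ℝ) := by
      have : b i i * star (b i i) = (Complex.normSq (b i i) : ℂ) := Complex.mul_conj _
      rw [this] at h6
      exact_mod_cast h6
    have hpos : 0 < Complex.normSq (b i i) := Complex.normSq_pos.2 (tri_diag_ne hb tb i)
    rcases hs.2.1 i i with h | h | h <;> rcases ht.2.1 i i with g | g | g <;>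
      simp [h, g] at h7 hz htz ⊢ <;> linarith
  · have a1 := hs.2.2.2.2 i j hij
    have a2 := ht.2.2.2.2 i j hij
    rcases hs.2.1 i j with h | h | h <;> rcases ht.2.1 i j with g | g | g <;> omega

/-- bordered matrix -/
def bl {R : Type*} {n : ℕ} (a : R) (v w : Fin n → R) (M : Matrix (Fin n) (Fin n) R) :
    Matrix (Fin (n+1)) (Fin (n+1)) R :=
  Matrix.of (Fin.cons (Fin.cons a v : Fin (n+1) → R)
    (fun i => (Fin.cons (w i) (M i) : Fin (n+1) → R)))

section
variable {R : Type*} {n : ℕ} (a : R) (v w : Fin n → R) (M : Matrix (Fin n) (Fin n) R)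
@[simp] theorem bl_00 : bl a v w M 0 0 = a := rfl
@[simp] theorem bl_0s (j : Fin n) : bl a v w M 0 j.succ = v j := rfl
@[simp] theorem bl_s0 (i : Fin n) : bl a v w M i.succ 0 = w i := rfl
@[simp] theorem bl_ss (i j : Fin n) : bl a v w M i.succ j.succ = M i j := rfl
end

theorem bl_map {n : ℕ} (a : ℤ) (v w : Fin n → ℤ) (M : Matrix (Fin n) (Fin n) ℤ) :
    (bl a v w M).map (fun x : ℤ => (x : ℂ)) = bl (a : ℂ) (fun i => (v i : ℂ)) (fun i => (w i : ℂ))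
      (M.map (fun x : ℤ => (x : ℂ))) := by
  ext i j
  refine Fin.cases ?_ (fun i => ?_) i <;> refine Fin.cases ?_ (fun j => ?_) j <;> simp

theorem bl_herm_eq {n : ℕ} {z : Matrix (Fin (n+1)) (Fin (n+1)) ℂ} (hz : z.IsHermitian) :
    z = bl (z 0 0) (fun i => star (z i.succ 0)) (fun i => z i.succ 0)
      (z.submatrix Fin.succ Fin.succ) := by
  ext i j
  refine Fin.cases ?_ (fun i => ?_) i <;> refine Fin.cases ?_ (fun j => ?_) j <;> simp
  exact (hz.apply 0 j.succ).symm

theorem bl_tri {n : ℕ} (c : ℂ) (u : Fin n → ℂ) {B : Matrix (Fin n) (Fin n) ℂ}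
    (tb : B.BlockTriangular id) : (bl c u 0 B).BlockTriangular id := by
  intro i j
  refine Fin.cases ?_ (fun i => ?_) i <;> refine Fin.cases ?_ (fun j => ?_) j
  · simp
  · simp
  · simp
  · intro h
    exact tb (by simpa using h)

theorem isUnit_of_tri {n : ℕ} {B : Matrix (Fin n) (Fin n) ℂ}
    (tb : B.BlockTriangular id) (h : ∀ i, B i i ≠ 0) : IsUnit B := by
  rw [Matrix.isUnit_iff_isUnit_det, Matrix.det_of_isUpperTriangular tb, isUnit_iff_ne_zero]
  exact Finset.prod_ne_zero_iff.2 (fun i _ => h i)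

/-- unbundled relation -/
def RR {m : ℕ} (z z' : Matrix (Fin m) (Fin m) ℂ) : Prop :=
  ∃ b : Matrix (Fin m) (Fin m) ℂ, IsUnit b ∧ b.BlockTriangular id ∧ b * z * bᴴ = z'

theorem RR.trans {m : ℕ} {x y z : Matrix (Fin m) (Fin m) ℂ} (h : RR x y) (h' : RR y z) :
    RR x z := by
  obtain ⟨b, hb, tb, e⟩ := h
  obtain ⟨c, hc, tc, e'⟩ := h'
  refine ⟨c * b, hc.mul hb, tc.mul tb, ?_⟩
  rw [← e', ← e, Matrix.conjTranspose_mul]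
  simp only [Matrix.mul_assoc]

/-- One step. -/
theorem RR_step {n : ℕ} (a : ℂ) (w : Fin n → ℂ) (M : Matrix (Fin n) (Fin n) ℂ)
    (hM : M.IsHermitian)
    (c : ℂ) (hc : c ≠ 0) (u : Fin n → ℂ) (B : Matrix (Fin n) (Fin n) ℂ)
    (tb : B.BlockTriangular id) (hB : IsUnit B) :
    RR (bl a (star w) w M)
      (bl ((c * a + u ⬝ᵥ w) * star c + (c • star w + u ᵥ* M) ⬝ᵥ star u)
        (star (B *ᵥ (star c • w + M *ᵥ star u)))
        (B *ᵥ (star c • w + M *ᵥ star u)) (B * M * Bᴴ)) := by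
  refine ⟨bl c u 0 B, isUnit_of_tri (bl_tri c u tb) ?_, bl_tri c u tb, ?_⟩
  · intro i
    refine Fin.cases ?_ (fun i => ?_) i
    · simpa
    · simpa using tri_diag_ne hB tb i
  · have e1 : bl c u 0 B * bl a (star w) w M =
        bl (c * a + u ⬝ᵥ w) (c • star w + u ᵥ* M) (B *ᵥ w) (B * M) := by
      ext i j
      refine Fin.cases ?_ (fun i => ?_) i <;> refine Fin.cases ?_ (fun j => ?_) j <;>
        simp [Matrix.mul_apply, Fin.sum_univ_succ, dotProduct, Matrix.vecMul, Matrix.mulVec]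
    have e2 : (bl c u 0 B)ᴴ = bl (star c) 0 (star u) Bᴴ := by
      ext i j
      refine Fin.cases ?_ (fun i => ?_) i <;> refine Fin.cases ?_ (fun j => ?_) j <;>
        simp [Matrix.conjTranspose_apply]
    have e4 : ∀ (p : ℂ) (q r : Fin n → ℂ) (N : Matrix (Fin n) (Fin n) ℂ),
        bl p q r N * bl (star c) 0 (star u) Bᴴ = bl (p * star c + q ⬝ᵥ star u) (q ᵥ* Bᴴ)
          (star c • r + N *ᵥ star u) (N * Bᴴ) := by
      intro p q r N
      ext i j
      refine Fin.cases ?_ (fun i => ?_) i <;> refine Fin.cases ?_ (fun j => ?_) j <;>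
        simp [Matrix.mul_apply, Fin.sum_univ_succ, dotProduct, Matrix.vecMul, Matrix.mulVec,
          mul_comm]
    have e5 : (c • star w + u ᵥ* M) ᵥ* Bᴴ = star (B *ᵥ (star c • w + M *ᵥ star u)) := by
      rw [Matrix.star_mulVec, star_add, star_smul, star_star, Matrix.star_mulVec, star_star, hM.eq]
    have e6 : star c • (B *ᵥ w) + (B * M) *ᵥ star u = B *ᵥ (star c • w + M *ᵥ star u) := by
      rw [Matrix.mulVec_add, Matrix.mulVec_smul, Matrix.mulVec_mulVec]
    rw [e1, e2, e4, e5, e6]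

theorem spi_bl {n : ℕ} {t : Matrix (Fin n) (Fin n) ℤ} (ht : IsSPIplus t)
    (a : ℤ) (ha : a = -1 ∨ a = 0 ∨ a = 1) : IsSPIplus (bl a 0 0 t) := by
  obtain ⟨h1, h2, h3, h4, h5⟩ := ht
  refine ⟨?_, ?_, ?_, ?_, ?_⟩
  · ext i j
    refine Fin.cases ?_ (fun i => ?_) i <;> refine Fin.cases ?_ (fun j => ?_) j <;> simp
    exact h1.apply _ _
  · intro i j
    refine Fin.cases ?_ (fun i => ?_) i <;> refine Fin.cases ?_ (fun j => ?_) j <;> simp [ha, h2]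
  · intro i j k
    refine Fin.cases ?_ (fun i => ?_) i <;> refine Fin.cases ?_ (fun j => ?_) j <;>
      refine Fin.cases ?_ (fun k => ?_) k <;> simp
    exact h3 _ _ _
  · intro i j k
    refine Fin.cases ?_ (fun i => ?_) i <;> refine Fin.cases ?_ (fun j => ?_) j <;>
      refine Fin.cases ?_ (fun k => ?_) k <;> simp
    exact h4 _ _ _
  · intro i j
    refine Fin.cases ?_ (fun i => ?_) i <;> refine Fin.cases ?_ (fun j => ?_) j <;> simp
    exact h5 _ _

theorem spi_bl' {n : ℕ} {t : Matrix (Fin n) (Fin n) ℤ} (ht : IsSPIplus t)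
    (l : Fin n) (hl : ∀ i, t i l = 0) :
    IsSPIplus (bl 0 (Pi.single l 1) (Pi.single l 1) t) := by
  obtain ⟨h1, h2, h3, h4, h5⟩ := ht
  have hl' : ∀ i, t l i = 0 := fun i => by rw [← hl i]; exact h1.apply _ _
  refine ⟨?_, ?_, ?_, ?_, ?_⟩
  · ext i j
    refine Fin.cases ?_ (fun i => ?_) i <;> refine Fin.cases ?_ (fun j => ?_) j <;> simp
    exact h1.apply _ _
  · intro i j
    refine Fin.cases ?_ (fun i => ?_) i <;> refine Fin.cases ?_ (fun j => ?_) j <;>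
      simp [h2, Pi.single_apply] <;> tauto
  · intro i j k
    refine Fin.cases ?_ (fun i => ?_) i <;> refine Fin.cases ?_ (fun j => ?_) j <;>
      refine Fin.cases ?_ (fun k => ?_) k <;> simp [Pi.single_apply]
    · rintro rfl rfl; rfl
    · rintro rfl h; exact absurd (hl' _) h
    · rintro h rfl; exact absurd (hl' _) h
    · exact h3 _ _ _
  · intro i j k
    refine Fin.cases ?_ (fun i => ?_) i <;> refine Fin.cases ?_ (fun j => ?_) j <;>
      refine Fin.cases ?_ (fun k => ?_) k <;> simp [Pi.single_apply]
    · rintro rfl h; exact absurd (hl _) h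
    · rintro h rfl; exact absurd (hl _) h
    · rintro rfl rfl; rfl
    · exact h4 _ _ _
  · intro i j
    refine Fin.cases ?_ (fun i => ?_) i <;> refine Fin.cases ?_ (fun j => ?_) j <;>
      simp [Pi.single_apply]
    · split_ifs <;> simp
    · split_ifs <;> simp
    · exact h5 _ _

theorem spi_sq {n : ℕ} {t : Matrix (Fin n) (Fin n) ℤ} (ht : IsSPIplus t) (w : Fin n → ℂ)
    (i j : Fin n) (hij : t j i ≠ 0) :
    (t.map (fun x : ℤ => (x : ℂ)) *ᵥ (t.map (fun x : ℤ => (x : ℂ)) *ᵥ w)) i = w i := by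
  obtain ⟨h1, h2, h3, h4, h5⟩ := ht
  have hs : t i j = t j i := h1.apply _ _
  have hmv : ∀ (v : Fin n → ℂ) (p q : Fin n), t p q ≠ 0 →
      (t.map (fun x : ℤ => (x : ℂ)) *ᵥ v) p = (t p q : ℂ) * v q := by
    intro v p q hpq
    rw [Matrix.mulVec, dotProduct, Finset.sum_eq_single q]
    · rfl
    · intro k _ hk
      have : t p k = 0 := by
        by_contra h
        exact hk (h3 p k q h hpq)
      simp [this]
    · simp
  rw [hmv _ i j (hs ▸ hij), hmv _ j i hij, hs]
  rcases h2 j i with h | h | h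
  · simp [h]
  · exact absurd h hij
  · simp [h]

theorem spi_exists : ∀ {n : ℕ} (z : Matrix (Fin n) (Fin n) ℂ), z.IsHermitian →
    ∃ t : Matrix (Fin n) (Fin n) ℤ, IsSPIplus t ∧ RR z (t.map (fun x : ℤ => (x : ℂ))) := by
  intro n
  induction n with
  | zero =>
    intro z _
    refine ⟨0, ⟨?_, ?_, ?_, ?_, ?_⟩, 1, isUnit_one, Matrix.blockTriangular_one, ?_⟩
    · exact Matrix.isSymm_zero
    all_goals try (intro i; exact i.elim0)
    ext i; exact i.elim0
  | succ n ih =>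
    intro z hz
    have hz' : (z.submatrix Fin.succ Fin.succ).IsHermitian := hz.submatrix _
    obtain ⟨t, ht, b, hb, tb, e⟩ := ih _ hz'
    set T := t.map (fun x : ℤ => (x : ℂ)) with hT
    have hTh : T.IsHermitian := spiMap_isHermitian ht.1
    -- step 1
    have s1 : ∃ (a : ℂ) (w : Fin n → ℂ), RR z (bl a (star w) w T) := by
      have := RR_step (z 0 0) (fun i => z i.succ 0) _ hz' 1 one_ne_zero 0 b tb hb
      rw [e] at this
      rw [bl_herm_eq hz]
      exact ⟨_, _, this⟩
    obtain ⟨a₁, w₁, r₁⟩ := s1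
    -- step 2
    have s2 : ∃ (a : ℂ) (w : Fin n → ℂ), (∀ i j, t j i ≠ 0 → w i = 0) ∧
        RR z (bl a (star w) w T) := by
      have := RR_step a₁ w₁ T hTh 1 one_ne_zero (- star (T *ᵥ w₁)) 1
        Matrix.blockTriangular_one isUnit_one
      simp only [Matrix.conjTranspose_one, Matrix.one_mul, Matrix.mul_one] at this
      refine ⟨_, _, ?_, r₁.trans this⟩
      intro i j hij
      have h := spi_sq ht w₁ i j hij
      rw [← hT] at h
      simp [Matrix.mulVec_neg] 
      simp only [Matrix.mulVec_mulVec] at h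
      simp [h]
    obtain ⟨a₂, w₂, hw, r₂⟩ := s2
    by_cases h0 : w₂ = 0
    · subst h0
      have ha : star a₂ = a₂ := by
        obtain ⟨c, -, -, e⟩ := r₂
        have hh : (c * z * cᴴ).IsHermitian := Matrix.isHermitian_mul_mul_conjTranspose c hz
        rw [e] at hh
        simpa using hh.apply 0 0
      obtain ⟨r, rfl⟩ : ∃ r : ℝ, (r : ℂ) = a₂ := Complex.conj_eq_iff_real.1 ha |>.imp fun _ h => h.symm
      have key : ∃ (c : ℝ) (s : ℤ), c ≠ 0 ∧ (s = -1 ∨ s = 0 ∨ s = 1) ∧ c * r * c = s := by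
        by_cases hr : r = 0
        · exact ⟨1, 0, one_ne_zero, by simp, by simp [hr]⟩
        · have hp : 0 < |r| := abs_pos.2 hr
          have hq : √|r| ≠ 0 := (Real.sqrt_pos.2 hp).ne'
          have hqq : √|r| * √|r| = |r| := Real.mul_self_sqrt hp.le
          rcases lt_or_gt_of_ne hr with h | h
          · refine ⟨(√|r|)⁻¹, -1, inv_ne_zero hq, by simp, ?_⟩
            rw [abs_of_neg h] at *
            field_simp
            push_cast
            nlinarith
          · refine ⟨(√|r|)⁻¹, 1, inv_ne_zero hq, by simp, ?_⟩
            rw [abs_of_pos h] at *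
            field_simp
            push_cast
            nlinarith
      obtain ⟨c, s, hc, hs, hcs⟩ := key
      refine ⟨bl s 0 0 t, spi_bl ht s hs, ?_⟩
      have := RR_step (r : ℂ) 0 T hTh (c : ℂ) (by exact_mod_cast hc) 0 1
        Matrix.blockTriangular_one isUnit_one
      rw [bl_map]
      convert r₂.trans this using 2
      · have : (c : ℂ) * r * c = s := by exact_mod_cast hcs
        simp [this]
      · ext; simp
      · ext; simp
      · simp [hT]
    · have : ∃ l, w₂ l ≠ 0 ∧ ∀ j, l < j → w₂ j = 0 := by
        obtain ⟨i, hi⟩ := Function.ne_iff.1 h0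
        obtain ⟨l, hl, hm⟩ := Finset.exists_max_image (Finset.univ.filter fun i => w₂ i ≠ 0) id
          ⟨i, by simpa using hi⟩
        refine ⟨l, by simpa using hl, fun j hj => ?_⟩
        by_contra h
        exact absurd (hm j (by simpa using h)) (not_le.2 hj)
      obtain ⟨l, hl, hmax⟩ := this
      have htl : ∀ j, t j l = 0 := by
        intro j
        by_contra h
        exact hl (hw l j h)
      have hTl : ∀ j, T j l = 0 := fun j => by simp [hT, htl]
      have hTl' : ∀ j, T l j = 0 := fun j => by
        rw [← hTh.apply l j, hTl, star_zero]
      -- elimination matrix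
      let x : Fin n → ℂ := fun j => if j = l then (w₂ l)⁻¹ else - (w₂ j / w₂ l)
      let B : Matrix (Fin n) (Fin n) ℂ := Matrix.of fun i j => if j = l then x i else
        if i = j then 1 else 0
      have hBne : ∀ i j, j ≠ l → B i j = if i = j then 1 else 0 := fun i j h => by simp [B, h]
      have hBl : ∀ i, B i l = x i := fun i => by simp [B]
      have tB : B.BlockTriangular id := by
        intro i j hij
        have hij' : j < i := hij
        by_cases h : j = l
        · subst h
          rw [hBl]
          simp [x, hij'.ne', hmax i hij']
        · rw [hBne _ _ h, if_neg hij'.ne']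
      have uB : IsUnit B := by
        refine isUnit_of_tri tB (fun i => ?_)
        by_cases h : i = l
        · subst h; rw [hBl]; simp [x, hl]
        · rw [hBne _ _ h]; simp
      have BT : B * T = T := by
        ext i j
        rw [Matrix.mul_apply]
        have : ∀ k, B i k * T k j = if i = k then T k j else 0 := by
          intro k
          by_cases h : k = l
          · subst h; simp [hTl']
          · rw [hBne _ _ h]; simp
        simp [this]
      have BTB : B * T * Bᴴ = T := by
        have := congrArg Matrix.conjTranspose BT
        rw [Matrix.conjTranspose_mul, hTh.eq] at this
        rw [BT, this]
      have Bw : B *ᵥ w₂ = Pi.single l 1 := by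
        ext i
        rw [Matrix.mulVec, dotProduct, ← Finset.add_sum_erase _ _ (Finset.mem_univ l)]
        have : ∀ k ∈ Finset.univ.erase l, B i k * w₂ k = if i = k then w₂ k else 0 := by
          intro k hk
          rw [hBne _ _ (Finset.ne_of_mem_erase hk)]; simp
        rw [Finset.sum_congr rfl this, hBl, Finset.sum_ite_eq]
        by_cases h : i = l
        · subst h; simp [x, hl]
        · simp [x, h, hl]
      have r₃ := RR_step a₂ w₂ T hTh 1 one_ne_zero 0 B tB uB
      rw [BTB] at r₃
      simp only [star_one, one_smul, star_zero, Matrix.mulVec_zero, add_zero, Bw] at r₃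
      replace r₃ := r₂.trans r₃
      generalize (1 * a₂ + 0 ⬝ᵥ w₂) * 1 + (star w₂ + 0 ᵥ* T) ⬝ᵥ 0 = a₃ at r₃
      have ha : star a₃ = a₃ := by
        obtain ⟨c, -, -, e⟩ := r₃
        have hh : (c * z * cᴴ).IsHermitian := Matrix.isHermitian_mul_mul_conjTranspose c hz
        rw [e] at hh
        simpa using hh.apply 0 0
      have r₄ := RR_step a₃ (Pi.single l 1) T hTh 1 one_ne_zero (Pi.single l (-(a₃/2))) 1
        Matrix.blockTriangular_one isUnit_one
      refine ⟨_, spi_bl' ht l htl, ?_⟩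
      rw [bl_map]
      have hTs : ∀ y : ℂ, T *ᵥ (Pi.single l y) = 0 := by
        intro y; ext i; simp [hTl]
      have hTs' : ∀ y : ℂ, (Pi.single l y) ᵥ* T = 0 := by
        intro y; ext i; simp [hTl']
      have hst : ∀ y : ℂ, star (Pi.single l y : Fin n → ℂ) = Pi.single l (star y) := by
        intro y; ext i; by_cases h : i = l <;> simp [Pi.single_apply, h]
      have hcast : (fun i => (((Pi.single l 1 : Fin n → ℤ) i : ℤ) : ℂ)) = Pi.single l 1 := by
        ext i; simp [Pi.single_apply]
      rw [hcast]
      simp only [hst, hTs, hTs', Matrix.conjTranspose_one, Matrix.one_mul, Matrix.mul_one,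
        Matrix.one_mulVec, star_one, one_smul, add_zero, one_mul, mul_one] at r₄ r₃
      convert r₃.trans r₄ using 2
      simp [ha]
      ring

theorem stmt2 (m : ℕ) :
    Function.Bijective (fun τ : {τ : Matrix (Fin m) (Fin m) ℤ // IsSPIplus τ} =>
      Quot.mk (BOrbitRel m)
        ⟨(τ : Matrix (Fin m) (Fin m) ℤ).map (fun x : ℤ => (x : ℂ)),
          spiMap_isHermitian τ.2.1⟩) := by
  constructor
  · intro s t h
    exact Subtype.ext (spi_inj s.2 t.2 (borbit_exact h))
  · intro q
    induction q using Quot.ind with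
    | _ z =>
      obtain ⟨t, ht, r⟩ := spi_exists z.1 z.2
      refine ⟨⟨t, ht⟩, ?_⟩
      have r' : BOrbitRel m z ⟨t.map (fun x : ℤ => (x : ℂ)), spiMap_isHermitian ht.1⟩ := r
      exact (Quot.sound r').symm
end

section
/- The map sending τ ∈ SPI⁺_m to its B_m(ℝ)-orbit is a bijection between SPI⁺_m and the set of orbits of the real upper triangular group B_m(ℝ) acting on real symmetric m×m matrices by b·z = b z bᵀ. -/
open Matrix

theorem spiMap_isSymm {m : ℕ} {τ : Matrix (Fin m) (Fin m) ℤ} (h : τ.IsSymm) :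
    (τ.map (fun x : ℤ => (x : ℝ))).IsSymm := by
  show _ᵀ = _
  ext i j
  simp [Matrix.transpose_apply, Matrix.map_apply, h.apply i j]

/-- The orbit relation of `B_m(ℝ)` acting by `b · z = b z bᵀ` on real symmetric
matrices. -/
def BOrbitRelR (m : ℕ) (z z' : {z : Matrix (Fin m) (Fin m) ℝ // z.IsSymm}) : Prop :=
  ∃ b : Matrix (Fin m) (Fin m) ℝ, IsUnit b ∧ b.BlockTriangular id ∧
    b * (z : Matrix (Fin m) (Fin m) ℝ) * bᵀ = (z' : Matrix (Fin m) (Fin m) ℝ)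

/-- Existence of the normal form, for symmetric matrices supported on `S × S`. -/
theorem exists_normal_form {m : ℕ} (S : Finset (Fin m)) :
    ∀ z : Fin m → Fin m → ℝ, (∀ i j, z i j = z j i) → (∀ i j, z i j ≠ 0 → i ∈ S) →
    ∃ (c : Fin m → Fin m → ℝ) (τ : Matrix (Fin m) (Fin m) ℤ),
      (∀ i j, j < i → c i j = 0) ∧ (∀ i, c i i ≠ 0) ∧ IsSPIplus τ ∧
      (∀ i j, τ i j ≠ 0 → i ∈ S) ∧
      (∀ i j, z i j = ∑ k, ∑ l, c i k * (τ k l : ℝ) * c j l) := by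
  induction S using Finset.strongInduction with
  | H S ih =>
  intro z hz hS
  by_cases hne : S.Nonempty
  swap
  · rw [Finset.not_nonempty_iff_eq_empty] at hne
    subst hne
    refine ⟨fun i j => if i = j then 1 else 0, 0, ?_, ?_, ?_, ?_, ?_⟩
    · intro i j h; simp [h.ne']
    · intro i; simp
    · refine ⟨by simp [Matrix.IsSymm], ?_, ?_, ?_, ?_⟩ <;> simp
    · simp
    · intro i j
      have : z i j = 0 := by
        by_contra h
        simpa using hS i j h
      simp [this]
  obtain ⟨s, hsS, hmax⟩ : ∃ s ∈ S, ∀ i ∈ S, i ≤ s :=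
    ⟨S.max' hne, S.max'_mem hne, fun i hi => S.le_max' i hi⟩
  have hS' : ∀ i j, i ∉ S → z i j = 0 := fun i j h => by
    by_contra h'
    exact h (hS i j h')
  by_cases hd : z s s = 0
  swap
  · -- diagonal pivot
    obtain ⟨c, τ, h1, h2, h3, h4, h5⟩ := ih (S.erase s) (Finset.erase_ssubset hsS)
      (fun i j => z i j - z i s * z j s / z s s)
      (fun i j => by simp only [hz i j, mul_comm (z i s)])
      (fun i j h => by
        rw [Finset.mem_erase]
        constructor
        · rintro rfl
          apply h
          rw [hz j i]
          field_simp
          ring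
        · by_contra hi
          apply h
          simp [hS' i _ hi])
    obtain ⟨g1, g2, g3, g4, g5⟩ := h3
    have gs : ∀ i j, τ i j = τ j i := fun i j => g1.apply j i
    have hr : 0 < Real.sqrt |z s s| := Real.sqrt_pos.2 (abs_pos.2 hd)
    have hr2 : Real.sqrt |z s s| * Real.sqrt |z s s| = |z s s| :=
      Real.mul_self_sqrt (abs_nonneg _)
    obtain ⟨ε, hε, hε2⟩ : ∃ ε : ℤ, (ε = 1 ∨ ε = -1) ∧ (ε : ℝ) * z s s = |z s s| := by
      rcases lt_or_gt_of_ne hd with h | h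
      · exact ⟨-1, by simp, by simp [abs_of_neg h]⟩
      · exact ⟨1, by simp, by simp [abs_of_pos h]⟩
    have hεε : (ε : ℝ) * ε = 1 := by rcases hε with rfl | rfl <;> norm_num
    have t1 : ∀ j, τ s j = 0 := fun j => by
      by_contra h
      simpa using h4 s j h
    have t2 : ∀ j, τ j s = 0 := fun j => by rw [gs]; exact t1 j
    refine ⟨fun i j => if j = s then z i s / Real.sqrt |z s s| else c i j,
      fun i j => (if i = s ∧ j = s then ε else 0) + τ i j, ?_, ?_, ?_, ?_, ?_⟩
    · intro i j h
      dsimp only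
      split_ifs with hj
      · subst hj
        rw [hS' i j (fun hi => absurd (hmax i hi) (not_le.2 h))]
        simp
      · exact h1 i j h
    · intro i
      dsimp only
      split_ifs with hj
      · subst hj
        exact div_ne_zero hd hr.ne'
      · exact h2 i
    · refine ⟨?_, ?_, ?_, ?_, ?_⟩
      · ext i j
        show (if j = s ∧ i = s then ε else 0) + τ j i = (if i = s ∧ j = s then ε else 0) + τ i j
        rw [gs j i]
        simp only [and_comm]
      all_goals grind
    · intro i j h
      by_cases hi : i = s
      · exact hi ▸ hsS
      · exact Finset.mem_of_mem_erase (h4 i j (by simpa [hi] using h))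
    · intro i j
      have key : ∀ k l, (if k = s then z i s / Real.sqrt |z s s| else c i k) *
          (((if k = s ∧ l = s then ε else 0) + τ k l : ℤ) : ℝ) *
          (if l = s then z j s / Real.sqrt |z s s| else c j l) =
          (if k = s then (if l = s then ε * (z i s * z j s) / |z s s| else 0) else 0) +
            c i k * (τ k l : ℝ) * c j l := by
        intro k l
        by_cases hk : k = s
        · subst hk
          by_cases hl : l = k
          · subst hl
            simp only [t1, and_self, if_true, Int.cast_add, Int.cast_zero, add_zero, mul_zero,
              zero_mul]
            generalize Real.sqrt |z l l| = r at hr hr2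
            rw [← hr2]
            field_simp
          · simp [t1, hl]
        · by_cases hl : l = s
          · subst hl
            simp [t2, hk]
          · simp [hk, hl]
      simp only [key, Finset.sum_add_distrib, ← h5]
      simp
      rw [← hε2]
      have : (ε : ℝ) ≠ 0 := by rcases hε with rfl | rfl <;> norm_num
      field_simp
      ring
  by_cases hcol : ∀ i, z i s = 0
  · -- zero column
    obtain ⟨c, τ, h1, h2, h3, h4, h5⟩ := ih (S.erase s) (Finset.erase_ssubset hsS) z hz
      (fun i j h => by
        rw [Finset.mem_erase]
        refine ⟨?_, hS i j h⟩
        rintro rfl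
        exact h (by rw [hz]; exact hcol j))
    exact ⟨c, τ, h1, h2, h3, fun i j h => Finset.mem_of_mem_erase (h4 i j h), h5⟩
  -- off-diagonal pivot
  push Not at hcol
  obtain ⟨k, hk, hkmax⟩ : ∃ k, z k s ≠ 0 ∧ ∀ i, z i s ≠ 0 → i ≤ k := by
    have hF : (Finset.univ.filter (fun i => z i s ≠ 0)).Nonempty := by
      obtain ⟨i, hi⟩ := hcol
      exact ⟨i, by simpa using hi⟩
    have h1 := Finset.max'_mem _ hF
    refine ⟨Finset.max' _ hF, by simpa using h1, fun i hi => Finset.le_max' _ _ ?_⟩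
    simpa using hi
  have hks : k ≠ s := by
    rintro rfl
    exact hk hd
  have hkS : k ∈ S := hS k s hk
  obtain ⟨p, hp⟩ : ∃ p : Fin m → ℝ, ∀ i, p i = z i s / z k s := ⟨_, fun _ => rfl⟩
  obtain ⟨q, hq⟩ : ∃ q : Fin m → ℝ, ∀ i, q i = z i k - z k k / 2 * p i := ⟨_, fun _ => rfl⟩
  have hpk : p k = 1 := by rw [hp]; exact div_self hk
  have hps : p s = 0 := by rw [hp, hd]; simp
  have hqk : q k = z k k / 2 := by rw [hq, hpk]; ring
  have hqs : q s = z k s := by rw [hq, hps, hz]; ring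
  have hpz : ∀ i, p i * z k s = z i s := fun i => by rw [hp]; field_simp
  obtain ⟨c, τ, h1, h2, h3, h4, h5⟩ := ih ((S.erase s).erase k)
    ((Finset.erase_subset _ _).trans_ssubset (Finset.erase_ssubset hsS))
    (fun i j => z i j - (p i * q j + q i * p j))
    (fun i j => by simp only [hz i j]; ring)
    (fun i j h => by
      rw [Finset.mem_erase, Finset.mem_erase]
      refine ⟨?_, ?_, ?_⟩
      · rintro rfl
        apply h
        simp only [hpk, hqk]
        rw [hq, hz]
        ring
      · rintro rfl
        apply h
        simp only [hps, hqs]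
        rw [hz, ← hpz]
        ring
      · by_contra hi
        apply h
        simp [hq, hp, hS' i _ hi])
  obtain ⟨g1, g2, g3, g4, g5⟩ := h3
  have gs : ∀ i j, τ i j = τ j i := fun i j => g1.apply j i
  have t1 : ∀ j, τ s j = 0 := fun j => by
    by_contra h
    simpa using h4 s j h
  have t2 : ∀ j, τ j s = 0 := fun j => by rw [gs]; exact t1 j
  have t3 : ∀ j, τ k j = 0 := fun j => by
    by_contra h
    simpa using h4 k j h
  have t4 : ∀ j, τ j k = 0 := fun j => by rw [gs]; exact t3 j
  refine ⟨fun i j => if j = s then q i else if j = k then p i else c i j,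
    fun i j => (if i = k ∧ j = s then 1 else 0) + (if i = s ∧ j = k then 1 else 0) + τ i j,
    ?_, ?_, ?_, ?_, ?_⟩
  · intro i j h
    dsimp only
    split_ifs with hj hj'
    · subst hj
      have : i ∉ S := fun hi => absurd (hmax i hi) (not_le.2 h)
      rw [hq, hp, hS' i _ this, hS' i _ this]
      simp
    · subst hj'
      have : z i s = 0 := by
        by_contra hi
        exact absurd (hkmax i hi) (not_le.2 h)
      rw [hp, this]
      simp
    · exact h1 i j h
  · intro i
    dsimp only
    split_ifs with hj hj'
    · rw [hj, hqs]; exact hk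
    · rw [hj', hpk]; exact one_ne_zero
    · exact h2 i
  · refine ⟨?_, ?_, ?_, ?_, ?_⟩
    · ext i j
      show (if j = k ∧ i = s then 1 else 0) + (if j = s ∧ i = k then 1 else 0) + τ j i =
        (if i = k ∧ j = s then 1 else 0) + (if i = s ∧ j = k then 1 else 0) + τ i j
      rw [gs j i]
      grind
    all_goals grind
  · intro i j h
    by_cases hi : i = s
    · exact hi ▸ hsS
    by_cases hi' : i = k
    · exact hi' ▸ hkS
    exact Finset.mem_of_mem_erase (Finset.mem_of_mem_erase (h4 i j (by simpa [hi, hi'] using h)))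
  · intro i j
    have key : ∀ a b, (if a = s then q i else if a = k then p i else c i a) *
        (((if a = k ∧ b = s then 1 else 0) + (if a = s ∧ b = k then 1 else 0) + τ a b : ℤ) : ℝ) *
        (if b = s then q j else if b = k then p j else c j b) =
        (if a = k then (if b = s then p i * q j else 0) else 0) +
        (if a = s then (if b = k then q i * p j else 0) else 0) +
          c i a * (τ a b : ℝ) * c j b := by
      intro a b
      by_cases ha : a = s
      · subst ha
        by_cases hb : b = k
        · subst hb
          simp [t1, hks, hks.symm]
        · simp [t1, hb, hks.symm]
      · by_cases ha' : a = k
        · subst ha'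
          by_cases hb : b = s
          · subst hb
            simp [t2, hks]
          · simp [t3, hb, hks]
        · by_cases hb : b = s
          · subst hb
            simp [t2, ha, ha']
          · by_cases hb' : b = k
            · subst hb'
              simp [t4, ha, ha']
            · simp [ha, ha', hb, hb']
    simp only [key, Finset.sum_add_distrib, ← h5]
    simp

theorem bOrbitRelR_equivalence (m : ℕ) : Equivalence (BOrbitRelR m) := by
  refine ⟨?_, ?_, ?_⟩
  · intro z
    exact ⟨1, isUnit_one, Matrix.blockTriangular_one, by simp⟩
  · rintro z z' ⟨b, hb, hb', h⟩
    have hdet : IsUnit b.det := (Matrix.isUnit_iff_isUnit_det b).1 hb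
    have := b.invertibleOfIsUnitDet hdet
    refine ⟨b⁻¹, (Matrix.isUnit_nonsing_inv_iff).2 hb,
      Matrix.blockTriangular_inv_of_blockTriangular hb', ?_⟩
    rw [← h, Matrix.transpose_nonsing_inv]
    have hdet' : IsUnit bᵀ.det := by rwa [Matrix.det_transpose]
    rw [Matrix.mul_assoc, Matrix.mul_assoc, Matrix.mul_assoc, Matrix.mul_nonsing_inv _ hdet',
      Matrix.mul_one, ← Matrix.mul_assoc, Matrix.nonsing_inv_mul _ hdet, Matrix.one_mul]
  · rintro x y z ⟨b, hb, hb', h⟩ ⟨c, hc, hc', h'⟩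
    refine ⟨c * b, hc.mul hb, hc'.mul hb', ?_⟩
    rw [← h', ← h, Matrix.transpose_mul]
    simp only [Matrix.mul_assoc]

/-- Two normal forms in the same orbit coincide. -/
theorem normal_form_unique {m : ℕ} (τ σ : Matrix (Fin m) (Fin m) ℤ) (hτ : IsSPIplus τ)
    (hσ : IsSPIplus σ) (b : Matrix (Fin m) (Fin m) ℝ) (hb : IsUnit b)
    (hbt : b.BlockTriangular id)
    (h : b * τ.map (fun x : ℤ => (x : ℝ)) * bᵀ = σ.map (fun x : ℤ => (x : ℝ))) : τ = σ := by
  have hdet : IsUnit b.det := (Matrix.isUnit_iff_isUnit_det b).1 hb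
  have hdet' : IsUnit bᵀ.det := by rwa [Matrix.det_transpose]
  have := b.invertibleOfIsUnitDet hdet
  have hct : (b⁻¹).BlockTriangular id := Matrix.blockTriangular_inv_of_blockTriangular hbt
  obtain ⟨c, hc⟩ : ∃ c, c = b⁻¹ := ⟨_, rfl⟩
  rw [← hc] at hct
  have hb0 : ∀ i j, j < i → b i j = 0 := fun i j hij => hbt hij
  have hc0 : ∀ i j, j < i → c i j = 0 := fun i j hij => hct hij
  have hdiag : ∀ i, b i i * c i i = 1 := by
    intro i
    have h1 : (b * c) i i = 1 := by
      rw [hc, Matrix.mul_nonsing_inv _ hdet]; simp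
    rw [Matrix.mul_apply, Finset.sum_eq_single i] at h1
    · exact h1
    · intro j _ hj
      rcases lt_or_gt_of_ne hj with h2 | h2
      · rw [hb0 i j h2, zero_mul]
      · rw [hc0 j i h2, mul_zero]
    · simp
  have hE : b * τ.map (fun x : ℤ => (x : ℝ)) = σ.map (fun x : ℤ => (x : ℝ)) * cᵀ := by
    rw [← h, hc, Matrix.transpose_nonsing_inv, Matrix.mul_assoc, Matrix.mul_nonsing_inv _ hdet',
      Matrix.mul_one]
  obtain ⟨a1, a2, a3, a4, a5⟩ := hτ
  obtain ⟨e1, e2, e3, e4, e5⟩ := hσ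
  -- the entries of the two sides
  have hL : ∀ i j k, τ k j ≠ 0 → (b * τ.map (fun x : ℤ => (x : ℝ))) i j = b i k * τ k j := by
    intro i j k hk
    rw [Matrix.mul_apply, Finset.sum_eq_single k]
    · simp
    · intro l _ hl
      have : τ l j = 0 := by
        by_contra h0
        exact hl (a4 l k j h0 hk)
      simp [this]
    · simp
  have hR : ∀ i j k, σ i k ≠ 0 →
      (σ.map (fun x : ℤ => (x : ℝ)) * cᵀ) i j = σ i k * c j k := by
    intro i j k hk
    rw [Matrix.mul_apply, Finset.sum_eq_single k]
    · simp
    · intro l _ hl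
      have : σ i l = 0 := by
        by_contra h0
        exact hl (e3 i l k h0 hk)
      simp [this]
    · simp
  have hL0 : ∀ i j, (b * τ.map (fun x : ℤ => (x : ℝ))) i j ≠ 0 → ∃ k, i ≤ k ∧ τ k j ≠ 0 := by
    intro i j hij
    rw [Matrix.mul_apply] at hij
    obtain ⟨k, _, hk⟩ := Finset.exists_ne_zero_of_sum_ne_zero hij
    refine ⟨k, ?_, ?_⟩
    · by_contra h0
      exact hk (by rw [hb0 i k (not_le.1 h0), zero_mul])
    · intro h0
      exact hk (by simp [h0])
  have hR0 : ∀ i j, (σ.map (fun x : ℤ => (x : ℝ)) * cᵀ) i j ≠ 0 → ∃ k, j ≤ k ∧ σ i k ≠ 0 := by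
    intro i j hij
    rw [Matrix.mul_apply] at hij
    obtain ⟨k, _, hk⟩ := Finset.exists_ne_zero_of_sum_ne_zero hij
    refine ⟨k, ?_, ?_⟩
    · by_contra h0
      exact hk (by rw [Matrix.transpose_apply, hc0 j k (not_le.1 h0), mul_zero])
    · intro h0
      exact hk (by simp [h0])
  have hbn : ∀ i, b i i ≠ 0 := fun i => left_ne_zero_of_mul_eq_one (hdiag i)
  have hcn : ∀ i, c i i ≠ 0 := fun i => right_ne_zero_of_mul_eq_one (hdiag i)
  have up : ∀ i j, τ i j ≠ 0 → ∃ k, j ≤ k ∧ σ i k ≠ 0 := by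
    intro i j hij
    apply hR0
    rw [← hE, hL i j i hij]
    exact mul_ne_zero (hbn i) (by exact_mod_cast hij)
  have down : ∀ i j, σ i j ≠ 0 → ∃ k, i ≤ k ∧ τ k j ≠ 0 := by
    intro i j hij
    apply hL0
    rw [hE, hR i j j hij]
    exact mul_ne_zero (by exact_mod_cast hij) (hcn j)
  have as : ∀ i j, τ i j = τ j i := fun i j => a1.apply j i
  have es : ∀ i j, σ i j = σ j i := fun i j => e1.apply j i
  have s1 : ∀ i j, τ i j ≠ 0 → σ i j ≠ 0 := by
    intro i j hij
    obtain ⟨k, hjk, hk⟩ := up i j hij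
    obtain ⟨l, hkl, hl⟩ := down k i (by rwa [es])
    have : l = j := a3 i l j (by rwa [as]) hij
    have : k = j := le_antisymm (this ▸ hkl) hjk
    exact this ▸ hk
  have s2 : ∀ i j, σ i j ≠ 0 → τ i j ≠ 0 := by
    intro i j hij
    obtain ⟨k, hik, hk⟩ := down i j hij
    have := s1 k j hk
    exact (e4 k i j this hij) ▸ hk
  ext i j
  by_cases h0 : τ i j = 0
  · rw [h0]
    by_contra h1
    exact s2 i j (Ne.symm h1) h0
  have h1 := s1 i j h0
  by_cases hij : i = j
  · subst hij
    have h2 := hL i i i h0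
    rw [hE, hR i i i h1] at h2
    -- `σ = b ^ 2 * τ` on the diagonal
    have h3 : (σ i i : ℝ) = b i i * b i i * τ i i := by
      linear_combination b i i * h2 - (σ i i : ℝ) * hdiag i
    have h4 : 0 < b i i * b i i := mul_self_pos.2 (hbn i)
    rcases a2 i i with h5 | h5 | h5
    · rcases e2 i i with h6 | h6 | h6
      · rw [h5, h6]
      · exact absurd h6 h1
      · rw [h5, h6] at h3
        push_cast at h3
        linarith
    · exact absurd h5 h0
    · rcases e2 i i with h6 | h6 | h6
      · rw [h5, h6] at h3
        push_cast at h3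
        linarith
      · exact absurd h6 h1
      · rw [h5, h6]
  · have := a5 i j hij
    have := e5 i j hij
    have := a2 i j
    have := e2 i j
    omega

/-- The map sending `τ ∈ SPI⁺_m` to its `B_m(ℝ)`-orbit is a bijection onto the set
of orbits of `B_m(ℝ)` acting on `Sym_m(ℝ)` by `b · z = b z bᵀ`. -/
theorem stmt3 (m : ℕ) :
    Function.Bijective (fun τ : {τ : Matrix (Fin m) (Fin m) ℤ // IsSPIplus τ} =>
      Quot.mk (BOrbitRelR m)
        ⟨(τ : Matrix (Fin m) (Fin m) ℤ).map (fun x : ℤ => (x : ℝ)),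
          spiMap_isSymm τ.2.1⟩) := by
  constructor
  · intro τ σ h
    obtain ⟨b, hb, hbt, hE⟩ :=
      (bOrbitRelR_equivalence m).eqvGen_iff.1 (Quot.eqvGen_exact h)
    exact Subtype.ext (normal_form_unique _ _ τ.2 σ.2 b hb hbt hE)
  · intro x
    induction x using Quot.ind with
    | mk z =>
    obtain ⟨c, τ, h1, h2, h3, -, h5⟩ := exists_normal_form Finset.univ
      (z : Matrix (Fin m) (Fin m) ℝ) (fun i j => z.2.apply j i) (fun i _ _ => Finset.mem_univ i)
    refine ⟨⟨τ, h3⟩, Quot.sound ⟨Matrix.of c, ?_, ?_, ?_⟩⟩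
    · have hT : (Matrix.of c).IsUpperTriangular := fun i j h => h1 i j h
      rw [Matrix.isUnit_iff_isUnit_det, Matrix.det_of_isUpperTriangular hT]
      exact isUnit_iff_ne_zero.2 (Finset.prod_ne_zero_iff.2 fun i _ => h2 i)
    · exact fun i j h => h1 i j h
    · ext i j
      rw [h5, Finset.sum_comm]
      simp [Matrix.mul_apply, Finset.sum_mul]
end
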